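/- arXiv:1802.06060 — 2 statements merged into one kernel-verified Lean document; each statement's English description precedes it below -/
import Mathlib

section
/- Let G be a labeled weighted graph and Q a rooted query tree with label constraint ψ. For every query node u with children u_1, …, u_m (m ≥ 1) and every c ∈ V such that a subtree match at (u, c) exists, the minimum subtree weight satisfies the dynamic-programming recursion W(u, c) = Σ_{i=1}^{m} min { w({c, c'}) + W(u_i, c') : c' a neighbor of c in G with φ(c') = ψ(u_i) such that a subtree match at (u_i, c') exists }, where each of the m minima ranges over a nonempty set; moreover W(u, c) = 0 whenever u is a leaf of Q and φ(c) = ψ(u). (Correctness of the bottom-up minimum subtree weight computation.) -/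
open Finset
open scoped Classical

noncomputable section

/-- A finite rooted tree on node type `A`, given by its root and parent function. -/
structure QueryTree (A : Type) where
  root : A
  parent : A → A
  parent_root : parent root = root
  reaches : ∀ v : A, ∃ n : ℕ, parent^[n] v = root

variable {V L A : Type}

/-- A (complete) homomorphic match of the query tree `Q` (with label constraint `ψ`)
in the labeled graph `G` (with node labeling `φ`). -/
def IsMatch [Fintype A] [DecidableEq A] (G : SimpleGraph V) (φ : V → L)
    (Q : QueryTree A) (ψ : A → L) (lam : A → V) : Prop :=
  (∀ u : A, φ (lam u) = ψ u) ∧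
    ∀ u : A, u ≠ Q.root → G.Adj (lam u) (lam (Q.parent u))

/-- Weight of a complete homomorphic match: sum of the edge weights of the images of the
query edges (each non-root query node contributes its parent edge). -/
def matchWeight [Fintype A] [DecidableEq A] (w : Sym2 V → ℝ) (Q : QueryTree A)
    (lam : A → V) : ℝ :=
  ∑ u ∈ Finset.univ.filter (fun u : A => u ≠ Q.root), w s(lam u, lam (Q.parent u))

/-- The node set of the subtree `Q_u` of `Q` rooted at `u`: all descendants of `u`. -/
def desc (Q : QueryTree A) (u : A) : Set A := {v | ∃ n : ℕ, Q.parent^[n] v = u}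

/-- A subtree match at `(u, c)`: a homomorphic match of the subtree `Q_u` in `G`
mapping `u` to `c` (values outside `Q_u` are unconstrained). -/
def IsSubtreeMatch [Fintype A] [DecidableEq A] (G : SimpleGraph V) (φ : V → L)
    (Q : QueryTree A) (ψ : A → L) (u : A) (c : V) (μ : A → V) : Prop :=
  μ u = c ∧ (∀ v ∈ desc Q u, φ (μ v) = ψ v) ∧
    ∀ v ∈ desc Q u, v ≠ u → G.Adj (μ v) (μ (Q.parent v))

/-- Weight of a subtree match at `u`: sum of `w` over the images of the edges of `Q_u`. -/
def subtreeWeight [Fintype A] [DecidableEq A] (w : Sym2 V → ℝ) (Q : QueryTree A)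
    (u : A) (μ : A → V) : ℝ :=
  ∑ v ∈ Finset.univ.filter (fun v : A => v ∈ desc Q u ∧ v ≠ u),
    w s(μ v, μ (Q.parent v))

/-- There exists a subtree match at `(u, c)`. -/
def SubtreeMatchExists [Fintype A] [DecidableEq A] (G : SimpleGraph V) (φ : V → L)
    (Q : QueryTree A) (ψ : A → L) (u : A) (c : V) : Prop :=
  ∃ μ : A → V, IsSubtreeMatch G φ Q ψ u c μ

/-- Minimum subtree weight `W(u, c)`: the minimum of the weights of all subtree
matches at `(u, c)` (meaningful whenever such a match exists). -/
def minW [Fintype A] [DecidableEq A] (G : SimpleGraph V) (φ : V → L) (w : Sym2 V → ℝ)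
    (Q : QueryTree A) (ψ : A → L) (u : A) (c : V) : ℝ :=
  sInf {x : ℝ | ∃ μ : A → V, IsSubtreeMatch G φ Q ψ u c μ ∧ subtreeWeight w Q u μ = x}

/-- A rooted prefix of `Q`: contains the root and is closed under taking parents. -/
def IsRootedPrefix (Q : QueryTree A) (S : Finset A) : Prop :=
  Q.root ∈ S ∧ ∀ v ∈ S, Q.parent v ∈ S

/-- Boundary `∂S`: the query nodes outside `S` whose parent lies in `S`. -/
def boundary [Fintype A] [DecidableEq A] (Q : QueryTree A) (S : Finset A) : Finset A :=
  Finset.univ.filter (fun u : A => u ∉ S ∧ Q.parent u ∈ S)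

/-- A partial match on the rooted prefix `S`: a homomorphic match of the induced
subtree `Q[S]` in `G` (values outside `S` are unconstrained). -/
def IsPartialMatch [Fintype A] [DecidableEq A] (G : SimpleGraph V) (φ : V → L)
    (Q : QueryTree A) (ψ : A → L) (S : Finset A) (P : A → V) : Prop :=
  (∀ u ∈ S, φ (P u) = ψ u) ∧ ∀ u ∈ S, u ≠ Q.root → G.Adj (P u) (P (Q.parent u))

/-- The set `{ w({c, c'}) + W(u', c') : c' a neighbor of c, φ(c') = ψ(u'),
a subtree match at (u', c') exists }`. -/
def candSet [Fintype A] [DecidableEq A] (G : SimpleGraph V) (φ : V → L) (w : Sym2 V → ℝ)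
    (Q : QueryTree A) (ψ : A → L) (c : V) (u' : A) : Set ℝ :=
  {x : ℝ | ∃ c' : V, G.Adj c c' ∧ φ c' = ψ u' ∧ SubtreeMatchExists G φ Q ψ u' c' ∧
      x = w s(c, c') + minW G φ w Q ψ u' c'}

/-- Priority of a partial match `P` on the rooted prefix `S`. -/
def priorityVal [Fintype A] [DecidableEq A] (G : SimpleGraph V) (φ : V → L)
    (w : Sym2 V → ℝ) (Q : QueryTree A) (ψ : A → L) (S : Finset A) (P : A → V) : ℝ :=
  (∑ u ∈ S.filter (fun u : A => u ≠ Q.root), w s(P u, P (Q.parent u))) +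
    ∑ u' ∈ boundary Q S, sInf (candSet G φ w Q ψ (P (Q.parent u')) u')


/-- A query node on a cycle of the parent function is the root. -/
theorem QueryTree.eq_root_of_iterate_succ_eq (Q : QueryTree A) {u : A} {k : ℕ}
    (h : Q.parent^[k + 1] u = u) : u = Q.root := by
  obtain ⟨n, hn⟩ := Q.reaches u
  have hroot : ∀ m, Q.parent^[m] Q.root = Q.root :=
    fun m => Function.iterate_fixed Q.parent_root m
  have hcycle : Q.parent^[(k + 1) * n] u = u := by
    rw [Function.iterate_mul]
    exact Function.iterate_fixed h n
  have hle : (k + 1) * n = k * n + n := by ring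
  rw [hle, Function.iterate_add_apply, hn, hroot] at hcycle
  exact hcycle.symm

theorem self_mem_desc (Q : QueryTree A) (u : A) : u ∈ desc Q u := ⟨0, rfl⟩

theorem mem_desc_of_mem_desc_child {Q : QueryTree A} {u u' v : A} (h : Q.parent u' = u)
    (hv : v ∈ desc Q u') : v ∈ desc Q u := by
  obtain ⟨n, hn⟩ := hv
  exact ⟨n + 1, by rw [Function.iterate_succ_apply', hn, h]⟩

theorem parent_mem_desc {Q : QueryTree A} {u v : A} (hv : v ∈ desc Q u) (hne : v ≠ u) :
    Q.parent v ∈ desc Q u := by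
  obtain ⟨n, hn⟩ := hv
  cases n with
  | zero => exact absurd hn hne
  | succ k => exact ⟨k, hn⟩

theorem exists_child_of_mem_desc {Q : QueryTree A} {u v : A} (hv : v ∈ desc Q u)
    (hne : v ≠ u) : ∃ u', (Q.parent u' = u ∧ u' ≠ Q.root) ∧ v ∈ desc Q u' := by
  obtain ⟨n, hn⟩ := hv
  induction n with
  | zero => exact absurd hn hne
  | succ k ih =>
    rw [Function.iterate_succ_apply'] at hn
    by_cases hr : Q.parent^[k] v = Q.root
    · refine ih ?_
      rw [← hn, hr, Q.parent_root]
    · exact ⟨_, ⟨hn, hr⟩, k, rfl⟩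

theorem not_mem_desc_child {Q : QueryTree A} {u u' : A}
    (h : Q.parent u' = u ∧ u' ≠ Q.root) : u ∉ desc Q u' := by
  rintro ⟨k, hk⟩
  have hu : u = Q.root := Q.eq_root_of_iterate_succ_eq (k := k) (by
    rw [Function.iterate_succ_apply', hk, h.1])
  apply h.2
  rw [← hk, hu, Function.iterate_fixed Q.parent_root]

theorem child_eq_of_mem_desc {Q : QueryTree A} {u a b v : A}
    (ha : Q.parent a = u ∧ a ≠ Q.root) (hb : Q.parent b = u ∧ b ≠ Q.root)
    (hva : v ∈ desc Q a) (hvb : v ∈ desc Q b) : a = b := by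
  obtain ⟨n, hn⟩ := hva
  obtain ⟨m, hm⟩ := hvb
  wlog hnm : n ≤ m generalizing a b n m
  · exact (this hb ha m hm n hn (by omega)).symm
  obtain ⟨d, rfl⟩ := Nat.exists_eq_add_of_le' hnm
  rw [Function.iterate_add_apply, hn] at hm
  cases d with
  | zero => exact hm
  | succ k =>
    rw [Function.iterate_succ_apply, ha.1] at hm
    exact absurd ⟨k, hm⟩ (not_mem_desc_child hb)

section DynamicProgramming

variable [Fintype A] [DecidableEq A] {G : SimpleGraph V} {φ : V → L} {w : Sym2 V → ℝ}
  {Q : QueryTree A} {ψ : A → L}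

theorem IsSubtreeMatch.congr {u : A} {c : V} {μ ν : A → V}
    (hμ : IsSubtreeMatch G φ Q ψ u c μ) (h : ∀ v ∈ desc Q u, ν v = μ v) :
    IsSubtreeMatch G φ Q ψ u c ν := by
  refine ⟨(h u (self_mem_desc Q u)).trans hμ.1, fun v hv => ?_, fun v hv hne => ?_⟩
  · rw [h v hv]
    exact hμ.2.1 v hv
  · rw [h v hv, h _ (parent_mem_desc hv hne)]
    exact hμ.2.2 v hv hne

theorem subtreeWeight_congr {u : A} {μ ν : A → V} (h : ∀ v ∈ desc Q u, ν v = μ v) :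
    subtreeWeight w Q u ν = subtreeWeight w Q u μ := by
  refine Finset.sum_congr rfl fun v hv => ?_
  obtain ⟨hv, hne⟩ := (Finset.mem_filter.mp hv).2
  rw [h v hv, h _ (parent_mem_desc hv hne)]

/-- A subtree match at `(u, c)` consists of subtree matches at the children of `u`. -/
theorem isSubtreeMatch_iff {u : A} {c : V} {μ : A → V} :
    IsSubtreeMatch G φ Q ψ u c μ ↔ μ u = c ∧ φ c = ψ u ∧
      ∀ u', Q.parent u' = u ∧ u' ≠ Q.root →
        G.Adj c (μ u') ∧ IsSubtreeMatch G φ Q ψ u' (μ u') μ := by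
  constructor
  · rintro ⟨hc, hl, hadj⟩
    refine ⟨hc, hc ▸ hl u (self_mem_desc Q u), fun u' hu' => ⟨?_, rfl, ?_, ?_⟩⟩
    · have hne : u' ≠ u := by
        rintro rfl
        exact not_mem_desc_child hu' (self_mem_desc Q _)
      have := hadj u' (mem_desc_of_mem_desc_child hu'.1 (self_mem_desc Q u')) hne
      rw [hu'.1, hc] at this
      exact this.symm
    · exact fun v hv => hl v (mem_desc_of_mem_desc_child hu'.1 hv)
    · refine fun v hv _ => hadj v (mem_desc_of_mem_desc_child hu'.1 hv) ?_
      rintro rfl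
      exact not_mem_desc_child hu' hv
  · rintro ⟨hc, hl, hch⟩
    refine ⟨hc, fun v hv => ?_, fun v hv hne => ?_⟩
    · by_cases hne : v = u
      · rw [hne, hc, hl]
      · obtain ⟨u', hu', hv'⟩ := exists_child_of_mem_desc hv hne
        exact (hch u' hu').2.2.1 v hv'
    · obtain ⟨u', hu', hv'⟩ := exists_child_of_mem_desc hv hne
      by_cases hvu' : v = u'
      · rw [hvu', hu'.1, hc]
        exact (hch u' hu').1.symm
      · exact (hch u' hu').2.2.2 v hv' hvu'

theorem subtreeWeight_eq_sum_children (w : Sym2 V → ℝ) (Q : QueryTree A) (u : A)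
    (μ : A → V) :
    subtreeWeight w Q u μ =
      ∑ u' ∈ Finset.univ.filter (fun u' : A => Q.parent u' = u ∧ u' ≠ Q.root),
        (w s(μ u, μ u') + subtreeWeight w Q u' μ) := by
  have hunion : Finset.univ.filter (fun v : A => v ∈ desc Q u ∧ v ≠ u) =
      (Finset.univ.filter (fun u' : A => Q.parent u' = u ∧ u' ≠ Q.root)).biUnion
        (fun u' => Finset.univ.filter (fun v : A => v ∈ desc Q u')) := by
    ext v
    simp only [Finset.mem_filter, Finset.mem_univ, true_and, Finset.mem_biUnion]
    constructor
    · exact fun h => exists_child_of_mem_desc h.1 h.2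
    · rintro ⟨u', hu', hv⟩
      refine ⟨mem_desc_of_mem_desc_child hu'.1 hv, ?_⟩
      rintro rfl
      exact not_mem_desc_child hu' hv
  unfold subtreeWeight
  rw [hunion, Finset.sum_biUnion]
  · refine Finset.sum_congr rfl fun u' hu' => ?_
    have hpar := (Finset.mem_filter.mp hu').2.1
    have hinsert : Finset.univ.filter (fun v : A => v ∈ desc Q u') =
        insert u' (Finset.univ.filter (fun v : A => v ∈ desc Q u' ∧ v ≠ u')) := by
      ext v
      simp only [Finset.mem_filter, Finset.mem_univ, true_and, Finset.mem_insert]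
      by_cases hv : v = u'
      · simp [hv, self_mem_desc]
      · simp [hv]
    rw [hinsert, Finset.sum_insert (by simp), hpar, Sym2.eq_swap]
  · intro a ha b hb hab
    refine Finset.disjoint_left.mpr fun v hva hvb => hab ?_
    simp only [Finset.coe_filter, Finset.mem_univ, true_and, Set.mem_ofPred_eq] at ha hb
    exact child_eq_of_mem_desc ha hb (Finset.mem_filter.mp hva).2 (Finset.mem_filter.mp hvb).2

theorem IsSubtreeMatch.mem_candSet (w : Sym2 V → ℝ) {u u' : A} {c : V} {μ : A → V}
    (h : IsSubtreeMatch G φ Q ψ u c μ) (hu' : Q.parent u' = u ∧ u' ≠ Q.root) :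
    w s(c, μ u') + minW G φ w Q ψ u' (μ u') ∈ candSet G φ w Q ψ c u' := by
  obtain ⟨hadj, hm⟩ := (isSubtreeMatch_iff.mp h).2.2 u' hu'
  exact ⟨μ u', hadj, hm.2.1 u' (self_mem_desc Q u'), ⟨μ, hm⟩, rfl⟩

variable [Fintype V]

theorem finite_setOf_subtreeWeight (G : SimpleGraph V) (φ : V → L) (w : Sym2 V → ℝ)
    (Q : QueryTree A) (ψ : A → L) (u : A) (c : V) :
    {x : ℝ | ∃ μ : A → V,
      IsSubtreeMatch G φ Q ψ u c μ ∧ subtreeWeight w Q u μ = x}.Finite := by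
  refine (Set.finite_range (subtreeWeight w Q u)).subset ?_
  rintro x ⟨μ, -, rfl⟩
  exact ⟨μ, rfl⟩

theorem minW_le {u : A} {c : V} {μ : A → V} (h : IsSubtreeMatch G φ Q ψ u c μ) :
    minW G φ w Q ψ u c ≤ subtreeWeight w Q u μ :=
  csInf_le (finite_setOf_subtreeWeight G φ w Q ψ u c).bddBelow ⟨μ, h, rfl⟩

theorem exists_subtreeWeight_eq_minW (w : Sym2 V → ℝ) {u : A} {c : V}
    (h : SubtreeMatchExists G φ Q ψ u c) :
    ∃ μ, IsSubtreeMatch G φ Q ψ u c μ ∧ subtreeWeight w Q u μ = minW G φ w Q ψ u c := by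
  obtain ⟨μ, hμ⟩ := h
  have hne : {x : ℝ | ∃ μ : A → V,
      IsSubtreeMatch G φ Q ψ u c μ ∧ subtreeWeight w Q u μ = x}.Nonempty :=
    ⟨_, μ, hμ, rfl⟩
  exact hne.csInf_mem (finite_setOf_subtreeWeight G φ w Q ψ u c)

theorem finite_candSet (G : SimpleGraph V) (φ : V → L) (w : Sym2 V → ℝ)
    (Q : QueryTree A) (ψ : A → L) (c : V) (u' : A) : (candSet G φ w Q ψ c u').Finite := by
  refine (Set.finite_range fun c' => w s(c, c') + minW G φ w Q ψ u' c').subset ?_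
  rintro x ⟨c', -, -, -, rfl⟩
  exact Set.mem_range_self _

/-- Optimal choices at all the children of `u` glue to a single subtree match. -/
theorem exists_subtreeWeight_eq_sum_sInf_candSet {u : A} {c : V} (hc : φ c = ψ u)
    (hne : ∀ u', Q.parent u' = u ∧ u' ≠ Q.root → (candSet G φ w Q ψ c u').Nonempty) :
    ∃ μ, IsSubtreeMatch G φ Q ψ u c μ ∧ subtreeWeight w Q u μ =
      ∑ u' ∈ Finset.univ.filter (fun u' : A => Q.parent u' = u ∧ u' ≠ Q.root),
        sInf (candSet G φ w Q ψ c u') := by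
  have hopt : ∀ u', Q.parent u' = u ∧ u' ≠ Q.root → ∃ ν : A → V, G.Adj c (ν u') ∧
      IsSubtreeMatch G φ Q ψ u' (ν u') ν ∧
      w s(c, ν u') + subtreeWeight w Q u' ν = sInf (candSet G φ w Q ψ c u') := by
    intro u' hu'
    obtain ⟨c', hadj, -, hex, heq⟩ :=
      (hne u' hu').csInf_mem (finite_candSet G φ w Q ψ c u')
    obtain ⟨ν, hν, hw⟩ := exists_subtreeWeight_eq_minW w hex
    obtain rfl := hν.1
    exact ⟨ν, hadj, hν, by rw [hw, heq]⟩
  have : Nonempty (A → V) := ⟨fun _ => c⟩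
  choose! ν hadj hmatch hweight using hopt
  let μ : A → V := fun v =>
    if h : ∃ u', (Q.parent u' = u ∧ u' ≠ Q.root) ∧ v ∈ desc Q u' then ν h.choose v else c
  have hμu : μ u = c := dif_neg fun ⟨_, hu', hu⟩ => not_mem_desc_child hu' hu
  have hμ : ∀ u', Q.parent u' = u ∧ u' ≠ Q.root → ∀ v ∈ desc Q u', μ v = ν u' v := by
    intro u' hu' v hv
    have h : ∃ u', (Q.parent u' = u ∧ u' ≠ Q.root) ∧ v ∈ desc Q u' := ⟨u', hu', hv⟩
    have heq : h.choose = u' :=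
      child_eq_of_mem_desc h.choose_spec.1 hu' h.choose_spec.2 hv
    calc μ v = ν h.choose v := dif_pos h
      _ = ν u' v := by rw [heq]
  refine ⟨μ, isSubtreeMatch_iff.mpr ⟨hμu, hc, fun u' hu' => ?_⟩, ?_⟩
  · rw [hμ u' hu' u' (self_mem_desc Q u')]
    exact ⟨hadj u' hu', (hmatch u' hu').congr (hμ u' hu')⟩
  · rw [subtreeWeight_eq_sum_children]
    refine Finset.sum_congr rfl fun u' hu' => ?_
    have hu' := (Finset.mem_filter.mp hu').2
    rw [← hweight u' hu', ← subtreeWeight_congr (hμ u' hu'),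
      ← hμ u' hu' u' (self_mem_desc Q u'), hμu]

/-- The recursion for the minimum subtree weight; for a leaf the sum is empty. -/
theorem minW_eq_sum_sInf_candSet {u : A} {c : V} (h : SubtreeMatchExists G φ Q ψ u c) :
    minW G φ w Q ψ u c =
      ∑ u' ∈ Finset.univ.filter (fun u' : A => Q.parent u' = u ∧ u' ≠ Q.root),
        sInf (candSet G φ w Q ψ c u') := by
  obtain ⟨μ, hμ, hmin⟩ := exists_subtreeWeight_eq_minW w h
  obtain ⟨hμu, hc, hch⟩ := isSubtreeMatch_iff.mp hμ
  apply le_antisymm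
  · obtain ⟨ν, hν, hw⟩ := exists_subtreeWeight_eq_sum_sInf_candSet (w := w) hc
      fun u' hu' => ⟨_, hμ.mem_candSet w hu'⟩
    exact hw ▸ minW_le hν
  · rw [← hmin, subtreeWeight_eq_sum_children]
    refine Finset.sum_le_sum fun u' hu' => ?_
    have hu' := (Finset.mem_filter.mp hu').2
    rw [hμu]
    exact (csInf_le (finite_candSet G φ w Q ψ c u').bddBelow (hμ.mem_candSet w hu')).trans
      (add_le_add_right (minW_le (hch u' hu').2) _)

end DynamicProgramming

/-- correctness of the bottom-up minimum subtree weight computation: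
for a non-leaf `u` and a candidate `c` admitting a subtree match, each of the child
minima ranges over a nonempty set and `W(u,c)` satisfies the DP recursion; for a leaf
`u` and `c` with `φ(c) = ψ(u)`, `W(u,c) = 0`. -/
theorem stmt1 [Fintype V] [DecidableEq V] [Fintype A] [DecidableEq A]
    (G : SimpleGraph V) (φ : V → L) (w : Sym2 V → ℝ) (Q : QueryTree A) (ψ : A → L) :
    (∀ (u : A) (c : V),
      (∃ u' : A, Q.parent u' = u ∧ u' ≠ Q.root) →
      SubtreeMatchExists G φ Q ψ u c →
      (∀ u' : A, Q.parent u' = u → u' ≠ Q.root →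
        (candSet G φ w Q ψ c u').Nonempty) ∧
      minW G φ w Q ψ u c =
        ∑ u' ∈ Finset.univ.filter (fun u' : A => Q.parent u' = u ∧ u' ≠ Q.root),
          sInf (candSet G φ w Q ψ c u')) ∧
    (∀ (u : A) (c : V),
      (¬ ∃ u' : A, Q.parent u' = u ∧ u' ≠ Q.root) →
      φ c = ψ u → minW G φ w Q ψ u c = 0) := by
  refine ⟨fun u c _ hex => ⟨fun u' hpar hroot => ?_, minW_eq_sum_sInf_candSet hex⟩,
    fun u c hleaf hc => ?_⟩
  · obtain ⟨μ, hμ⟩ := hex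
    exact ⟨_, hμ.mem_candSet w ⟨hpar, hroot⟩⟩
  · have hex : SubtreeMatchExists G φ Q ψ u c :=
      ⟨fun _ => c, isSubtreeMatch_iff.mpr ⟨rfl, hc, fun u' hu' => absurd ⟨u', hu'⟩ hleaf⟩⟩
    rw [minW_eq_sum_sInf_candSet hex]
    exact Finset.sum_eq_zero fun u' hu' =>
      absurd ⟨u', (Finset.mem_filter.mp hu').2⟩ hleaf
end
end

section
/- Let G be a labeled weighted graph and Q a rooted query tree with label constraint ψ, and let r_H denote the number of complete homomorphic matches of Q in G. In every (possibly incomplete) run of the front-element-optimized best-first search process, the total number of partial matches ever inserted into the multiset B — counting the one-node partial matches of the initial state together with all insertions performed during macro-steps — is at most r_H. -/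
open Finset
open scoped Classical

noncomputable section

variable {V L A : Type}

variable [Fintype V] [DecidableEq V] [Fintype A] [DecidableEq A]

/-- A partial-match candidate: a set of query nodes together with an assignment. -/
abbrev PM (V A : Type) := Finset A × (A → V)

/-- A viable partial match: a partial match on a rooted prefix that has at least one
complete homomorphic match as a successor. -/
def Viable (G : SimpleGraph V) (φ : V → L) (Q : QueryTree A) (ψ : A → L)
    (pm : PM V A) : Prop :=
  IsRootedPrefix Q pm.1 ∧ IsPartialMatch G φ Q ψ pm.1 pm.2 ∧
    ∃ lam : A → V, IsMatch G φ Q ψ lam ∧ ∀ u ∈ pm.1, lam u = pm.2 u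

/-- A preorder (DFS) traversal of the rooted tree `Q`: an injective numbering in which
every non-root node comes after its parent and every subtree is contiguous. -/
structure DfsOrder {A : Type} (Q : QueryTree A) : Type where
  ord : A → ℕ
  inj : Function.Injective ord
  parent_lt : ∀ v : A, v ≠ Q.root → ord (Q.parent v) < ord v
  contiguous : ∀ u v x : A, v ∈ desc Q u → ord u ≤ ord x → ord x ≤ ord v → x ∈ desc Q u

/-- The next query node for a non-complete partial match on `S`: the first node of the
boundary `∂S` in the fixed preorder. -/
def nextNode (Q : QueryTree A) (D : DfsOrder Q) (S : Finset A) : A :=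
  if h : (boundary Q S).Nonempty then
    Classical.choose (Finset.exists_min_image (boundary Q S) D.ord h)
  else Q.root

/-- The viable direct successors of `pm` obtained by assigning some graph node to the
next query node. -/
def extOptionsF (G : SimpleGraph V) (φ : V → L) (Q : QueryTree A) (ψ : A → L)
    (D : DfsOrder Q) (pm : PM V A) : Finset (PM V A) :=
  Finset.univ.filter (fun pm' : PM V A =>
    ∃ c' : V, pm'.1 = insert (nextNode Q D pm.1) pm.1 ∧
      pm'.2 = Function.update pm.2 (nextNode Q D pm.1) c' ∧
      Viable G φ Q ψ pm')

/-- `ExtendsTo pm ins t final`: starting from the popped partial match `pm`, the inner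
loop of a macro-step performs `t` extension steps, each time retaining a viable direct
successor of minimum priority at the next query node and inserting all the other viable
direct successors (collected in the multiset `ins`), until the retained partial match
`final` is complete. -/
inductive ExtendsTo (G : SimpleGraph V) (φ : V → L) (w : Sym2 V → ℝ)
    (Q : QueryTree A) (ψ : A → L) (D : DfsOrder Q) :
    PM V A → Multiset (PM V A) → ℕ → PM V A → Prop
  | done (pm : PM V A) (h : pm.1 = Finset.univ) : ExtendsTo G φ w Q ψ D pm 0 0 pm
  | step (pm pm' final : PM V A) (ins : Multiset (PM V A)) (t : ℕ)
      (hne : pm.1 ≠ Finset.univ)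
      (hmem : pm' ∈ extOptionsF G φ Q ψ D pm)
      (hmin : ∀ q ∈ extOptionsF G φ Q ψ D pm,
        priorityVal G φ w Q ψ pm'.1 pm'.2 ≤ priorityVal G φ w Q ψ q.1 q.2)
      (hrest : ExtendsTo G φ w Q ψ D pm' ins t final) :
      ExtendsTo G φ w Q ψ D pm
        (((extOptionsF G φ Q ψ D pm).erase pm').val + ins) (t + 1) final

/-- A state of the front-element-optimized best-first search process: the multiset `B`
of stored partial matches together with the output sequence of complete matches. -/
abbrev SearchState (V A : Type) := Multiset (PM V A) × List (A → V)

/-- A macro-step of the process: remove from `B` a partial match of minimum priority,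
extend it (front-element optimization) to a complete match, insert the bypassed viable
direct successors into `B`, and append the complete match to the output. -/
def StepRel (G : SimpleGraph V) (φ : V → L) (w : Sym2 V → ℝ)
    (Q : QueryTree A) (ψ : A → L) (D : DfsOrder Q)
    (s s' : SearchState V A) : Prop :=
  ∃ (pm final : PM V A) (ins : Multiset (PM V A)) (t : ℕ),
    pm ∈ s.1 ∧
    (∀ q ∈ s.1, priorityVal G φ w Q ψ pm.1 pm.2 ≤ priorityVal G φ w Q ψ q.1 q.2) ∧
    ExtendsTo G φ w Q ψ D pm ins t final ∧
    s'.1 = s.1.erase pm + ins ∧ s'.2 = s.2 ++ [final.2]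

/-- The multiset `B` of the initial state: all viable one-node partial matches
`r ↦ c`. -/
def initB (G : SimpleGraph V) (φ : V → L) (Q : QueryTree A) (ψ : A → L) :
    Multiset (PM V A) :=
  ((Finset.univ.filter (fun c : V =>
      Viable G φ Q ψ (({Q.root} : Finset A), Function.const A c))).val).map
    (fun c : V => (({Q.root} : Finset A), Function.const A c))

/-- The states reachable by a run of the process from the initial state. -/
def ReachableState (G : SimpleGraph V) (φ : V → L) (w : Sym2 V → ℝ)
    (Q : QueryTree A) (ψ : A → L) (D : DfsOrder Q) (s : SearchState V A) : Prop :=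
  Relation.ReflTransGen (StepRel G φ w Q ψ D) (initB G φ Q ψ, ([] : List (A → V))) s

/-- The number of complete homomorphic matches of `Q` in `G` (`r_H`). -/
def rH (G : SimpleGraph V) (φ : V → L) (Q : QueryTree A) (ψ : A → L) : ℕ :=
  (Finset.univ.filter (fun lam : A → V => IsMatch G φ Q ψ lam)).card

/-- `ReachableInsCount s n`: state `s` is reachable by a run of the process during which
the total number of partial matches ever inserted into `B` — the one-node partial
matches of the initial state together with all insertions performed during
macro-steps — is `n`. -/
inductive ReachableInsCount (G : SimpleGraph V) (φ : V → L) (w : Sym2 V → ℝ)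
    (Q : QueryTree A) (ψ : A → L) (D : DfsOrder Q) : SearchState V A → ℕ → Prop
  | init : ReachableInsCount G φ w Q ψ D (initB G φ Q ψ, ([] : List (A → V)))
      (Multiset.card (initB G φ Q ψ))
  | step {s : SearchState V A} {n : ℕ} {s' : SearchState V A}
      (pm final : PM V A) (ins : Multiset (PM V A)) (t : ℕ)
      (hreach : ReachableInsCount G φ w Q ψ D s n)
      (hpm : pm ∈ s.1)
      (hmin : ∀ q ∈ s.1,
        priorityVal G φ w Q ψ pm.1 pm.2 ≤ priorityVal G φ w Q ψ q.1 q.2)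
      (hext : ExtendsTo G φ w Q ψ D pm ins t final)
      (hB : s'.1 = s.1.erase pm + ins) (hout : s'.2 = s.2 ++ [final.2]) :
      ReachableInsCount G φ w Q ψ D s' (n + Multiset.card ins)

/-- The complete homomorphic matches that are successors of a partial match. -/
def completions (G : SimpleGraph V) (φ : V → L) (Q : QueryTree A) (ψ : A → L)
    (pm : PM V A) : Finset (A → V) :=
  Finset.univ.filter (fun lam : A → V => IsMatch G φ Q ψ lam ∧ ∀ u ∈ pm.1, lam u = pm.2 u)

lemma mem_completions {G : SimpleGraph V} {φ : V → L} {Q : QueryTree A} {ψ : A → L}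
    {pm : PM V A} {lam : A → V} :
    lam ∈ completions G φ Q ψ pm ↔ IsMatch G φ Q ψ lam ∧ ∀ u ∈ pm.1, lam u = pm.2 u := by
  simp [completions]

lemma Viable.one_le_card_completions {G : SimpleGraph V} {φ : V → L} {Q : QueryTree A}
    {ψ : A → L} {pm : PM V A} (h : Viable G φ Q ψ pm) :
    1 ≤ (completions G φ Q ψ pm).card := by
  obtain ⟨-, -, lam, hlam⟩ := h
  exact Finset.card_pos.2 ⟨lam, mem_completions.2 hlam⟩

lemma boundary_nonempty {Q : QueryTree A} {S : Finset A}
    (hroot : Q.root ∈ S) (hne : S ≠ Finset.univ) : (boundary Q S).Nonempty := by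
  by_contra hempty
  have hclosed : ∀ u : A, Q.parent u ∈ S → u ∈ S := by
    intro u hu
    by_contra hnot
    exact hempty ⟨u, by simp [boundary, hu, hnot]⟩
  have hiter : ∀ (k : ℕ) (v : A), Q.parent^[k] v ∈ S → v ∈ S := by
    intro k
    induction k with
    | zero => exact fun v hv => hv
    | succ k ih => exact fun v hv => hclosed v (ih _ hv)
  refine hne (Finset.eq_univ_iff_forall.2 fun v => ?_)
  obtain ⟨k, hk⟩ := Q.reaches v
  exact hiter k v (hk ▸ hroot)

lemma nextNode_notMem {Q : QueryTree A} (D : DfsOrder Q) {S : Finset A}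
    (hroot : Q.root ∈ S) (hne : S ≠ Finset.univ) : nextNode Q D S ∉ S := by
  have hb := boundary_nonempty hroot hne
  have hmem : nextNode Q D S ∈ boundary Q S := by
    rw [nextNode, dif_pos hb]
    exact (Classical.choose_spec (Finset.exists_min_image (boundary Q S) D.ord hb)).1
  exact (Finset.mem_filter.1 hmem).2.1

lemma mem_extOptionsF {G : SimpleGraph V} {φ : V → L} {Q : QueryTree A} {ψ : A → L}
    {D : DfsOrder Q} {pm q : PM V A} :
    q ∈ extOptionsF G φ Q ψ D pm ↔
      ∃ c' : V, q.1 = insert (nextNode Q D pm.1) pm.1 ∧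
        q.2 = Function.update pm.2 (nextNode Q D pm.1) c' ∧ Viable G φ Q ψ q := by
  simp [extOptionsF]

lemma sum_card_completions_extOptionsF_le {G : SimpleGraph V} {φ : V → L} {Q : QueryTree A}
    {ψ : A → L} (D : DfsOrder Q) {pm : PM V A} (hroot : Q.root ∈ pm.1)
    (hne : pm.1 ≠ Finset.univ) :
    ∑ q ∈ extOptionsF G φ Q ψ D pm, (completions G φ Q ψ q).card ≤
      (completions G φ Q ψ pm).card := by
  have hx := nextNode_notMem D hroot hne
  rw [← Finset.card_biUnion]
  · refine Finset.card_le_card fun lam hlam => ?_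
    obtain ⟨q, hq, hlq⟩ := Finset.mem_biUnion.1 hlam
    obtain ⟨c, h1, h2, -⟩ := mem_extOptionsF.1 hq
    obtain ⟨hm, hag⟩ := mem_completions.1 hlq
    refine mem_completions.2 ⟨hm, fun u hu => ?_⟩
    have hux : u ≠ nextNode Q D pm.1 := fun e => hx (e ▸ hu)
    rw [hag u (h1 ▸ Finset.mem_insert_of_mem hu), h2, Function.update_of_ne hux]
  · intro q hq q' hq' hqq'
    refine Finset.disjoint_left.2 fun lam hl hl' => hqq' ?_
    obtain ⟨c, h1, h2, -⟩ := mem_extOptionsF.1 hq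
    obtain ⟨c', h1', h2', -⟩ := mem_extOptionsF.1 hq'
    have e := (mem_completions.1 hl).2 _ (h1 ▸ Finset.mem_insert_self _ _)
    have e' := (mem_completions.1 hl').2 _ (h1' ▸ Finset.mem_insert_self _ _)
    rw [h2, Function.update_self] at e
    rw [h2', Function.update_self] at e'
    refine Prod.ext (h1.trans h1'.symm) ?_
    rw [h2, h2', ← e, ← e']

lemma ExtendsTo.viable_and_sum_lt {G : SimpleGraph V} {φ : V → L} {w : Sym2 V → ℝ}
    {Q : QueryTree A} {ψ : A → L} {D : DfsOrder Q} {pm final : PM V A}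
    {ins : Multiset (PM V A)} {t : ℕ} (h : ExtendsTo G φ w Q ψ D pm ins t final)
    (hv : Viable G φ Q ψ pm) :
    (∀ q ∈ ins, Viable G φ Q ψ q) ∧
      (ins.map fun q => (completions G φ Q ψ q).card).sum <
        (completions G φ Q ψ pm).card := by
  induction h with
  | done pm _ => exact ⟨by simp, by simpa using hv.one_le_card_completions⟩
  | step pm pm' final ins t hne hmem _ _ ih =>
    have hv' : ∀ q ∈ extOptionsF G φ Q ψ D pm, Viable G φ Q ψ q := fun q hq =>
      (mem_extOptionsF.1 hq).choose_spec.2.2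
    obtain ⟨hins, hlt⟩ := ih (hv' pm' hmem)
    refine ⟨fun q hq => ?_, ?_⟩
    · rcases Multiset.mem_add.1 hq with hq | hq
      · exact hv' q (Finset.mem_of_mem_erase hq)
      · exact hins q hq
    · have hsum := sum_card_completions_extOptionsF_le (G := G) (φ := φ) (ψ := ψ) D hv.1.1 hne
      rw [← Finset.sum_erase_add _ _ hmem] at hsum
      rw [Multiset.map_add, Multiset.sum_add]
      exact lt_of_lt_of_le (Nat.add_lt_add_left hlt _) hsum

lemma viable_of_mem_initB {G : SimpleGraph V} {φ : V → L} {Q : QueryTree A} {ψ : A → L}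
    {q : PM V A} (hq : q ∈ initB G φ Q ψ) : Viable G φ Q ψ q := by
  obtain ⟨c, hc, rfl⟩ := Multiset.mem_map.1 hq
  exact (Finset.mem_filter.1 hc).2

lemma sum_card_completions_initB_le (G : SimpleGraph V) (φ : V → L) (Q : QueryTree A)
    (ψ : A → L) :
    ((initB G φ Q ψ).map fun q => (completions G φ Q ψ q).card).sum ≤ rH G φ Q ψ := by
  rw [initB, Multiset.map_map]
  change ∑ c ∈ Finset.univ.filter (fun c : V =>
      Viable G φ Q ψ (({Q.root} : Finset A), Function.const A c)),
    (completions G φ Q ψ (({Q.root} : Finset A), Function.const A c)).card ≤ _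
  rw [← Finset.card_biUnion]
  · refine Finset.card_le_card fun lam hlam => ?_
    obtain ⟨c, -, hl⟩ := Finset.mem_biUnion.1 hlam
    exact Finset.mem_filter.2 ⟨Finset.mem_univ _, (mem_completions.1 hl).1⟩
  · intro c _ c' _ hcc'
    refine Finset.disjoint_left.2 fun lam hl hl' => hcc' ?_
    have e := (mem_completions.1 hl).2 _ (Finset.mem_singleton_self _)
    have e' := (mem_completions.1 hl').2 _ (Finset.mem_singleton_self _)
    exact e.symm.trans e'

lemma ReachableInsCount.viable_and_add_sum_le {G : SimpleGraph V} {φ : V → L}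
    {w : Sym2 V → ℝ} {Q : QueryTree A} {ψ : A → L} {D : DfsOrder Q}
    {s : SearchState V A} {n : ℕ} (h : ReachableInsCount G φ w Q ψ D s n) :
    (∀ q ∈ s.1, Viable G φ Q ψ q) ∧
      n + (s.1.map fun q => (completions G φ Q ψ q).card).sum ≤
        rH G φ Q ψ + Multiset.card s.1 := by
  induction h with
  | init =>
    refine ⟨fun q hq => viable_of_mem_initB hq, ?_⟩
    rw [add_comm]
    exact Nat.add_le_add_right (sum_card_completions_initB_le G φ Q ψ) _
  | @step s n s' pm final ins t _ hpm _ hext hB _ ih =>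
    obtain ⟨hv, hle⟩ := ih
    obtain ⟨hins, hlt⟩ := hext.viable_and_sum_lt (hv pm hpm)
    rw [hB]
    refine ⟨fun q hq => ?_, ?_⟩
    · rcases Multiset.mem_add.1 hq with hq | hq
      · exact hv q (Multiset.mem_of_mem_erase hq)
      · exact hins q hq
    · have hs := Multiset.cons_erase hpm
      rw [← hs, Multiset.map_cons, Multiset.sum_cons, Multiset.card_cons] at hle
      rw [Multiset.map_add, Multiset.sum_add, Multiset.card_add]
      omega

/-- in every (possibly incomplete) run of the process, the total number of
partial matches ever inserted into the multiset `B` — counting the one-node partial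
matches of the initial state together with all insertions performed during
macro-steps — is at most `r_H`. -/
theorem stmt10 (G : SimpleGraph V) (φ : V → L) (w : Sym2 V → ℝ)
    (Q : QueryTree A) (ψ : A → L) (D : DfsOrder Q)
    (s : SearchState V A) (n : ℕ)
    (h : ReachableInsCount G φ w Q ψ D s n) :
    n ≤ rH G φ Q ψ := by
  obtain ⟨hv, hle⟩ := h.viable_and_add_sum_le
  have hcard : Multiset.card s.1 ≤
      (s.1.map fun q => (completions G φ Q ψ q).card).sum := by
    have := Multiset.card_nsmul_le_sum (s := s.1.map fun q => (completions G φ Q ψ q).card)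
      (a := 1) fun x hx => by
        obtain ⟨q, hq, rfl⟩ := Multiset.mem_map.1 hx
        exact (hv q hq).one_le_card_completions
    simpa using this
  omega
end
end
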